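/- Let S be a set of states, A a nonempty set of actions, T : S × A → S a deterministic transition function, and r : S × A → ℝ a bounded reward function. Let 0 < γ_D < γ_{D-1} < ... < γ_0 < 1, let w ∈ ℝ^{D+1} have all components nonnegative with w ≠ 0, and set η(t) := Σ_{d=0}^D w_d Φ_d(t). For H ∈ ℕ define the proxy value function Ṽ*_{η,H}(s) := sup over (a_0,...,a_H) ∈ A^{H+1} of [ Σ_{t=0}^H (Σ_{d=0}^D (Γ^t w)_d) · r(s_t, a_t) + ‖Γ^{H+1} w‖ · V*(s_{H+1}) ], where s_0 = s, s_{t+1} = T(s_t, a_t), ‖·‖ is the Euclidean norm on ℝ^{D+1}, and V*(s) := sup over action sequences a : ℕ → A of Σ_{t=0}^∞ γ_0^t r(s_t, a_t). Then for every state s ∈ S: lim_{H→∞} Ṽ*_{η,H}(s) = V*_η(s). -/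

import Mathlib

/-- `Phi γ d t = Σ_{(a_0,...,a_d) ∈ ℕ^{d+1}, a_0+...+a_d = t} ∏_{i=0}^{d} γ_i^{a_i}`. -/
noncomputable def Phi (γ : ℕ → ℝ) (d t : ℕ) : ℝ :=
  ∑ a ∈ Finset.Nat.antidiagonalTuple (d + 1) t, ∏ i : Fin (d + 1), γ i ^ a i

/-- `Gam γ D` is the (D+1)×(D+1) matrix with `Γ_{ij} = γ_i` if `i ≤ j`, else `0`. -/
def Gam (γ : ℕ → ℝ) (D : ℕ) : Matrix (Fin (D + 1)) (Fin (D + 1)) ℝ :=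
  Matrix.of fun i j => if i ≤ j then γ i else 0

/-- Deterministic trajectory: `s_0 = s`, `s_{t+1} = T(s_t, a_t)`. -/
def traj {S A : Type*} (T : S → A → S) (s : S) (a : ℕ → A) : ℕ → S
  | 0 => s
  | t + 1 => T (traj T s a t) (a t)

/-- Optimal value for weights `η`: sup over action sequences of `Σ_t η(t) r(s_t, a_t)`. -/
noncomputable def Vstar {S A : Type*} (T : S → A → S) (r : S → A → ℝ) (η : ℕ → ℝ) (s : S) : ℝ :=
  ⨆ a : ℕ → A, ∑' t, η t * r (traj T s a t) (a t)

/-- Extension of a finite action sequence `(a_0,...,a_H)` to an infinite one (arbitrary tail). -/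
noncomputable def extSeq {A : Type*} [Nonempty A] (H : ℕ) (a : Fin (H + 1) → A) : ℕ → A :=
  fun t => if h : t < H + 1 then a ⟨t, h⟩ else Classical.arbitrary A

/-- Euclidean norm on `ℝ^m`. -/
noncomputable def eucNorm {m : ℕ} (v : Fin m → ℝ) : ℝ := Real.sqrt (∑ d, v d ^ 2)

theorem Phi_zero_left (γ : ℕ → ℝ) (t : ℕ) : Phi γ 0 t = γ 0 ^ t := by
  simp [Phi]

theorem Phi_succ_left (γ : ℕ → ℝ) (d t : ℕ) :
    Phi γ (d + 1) t =
      ∑ p ∈ Finset.HasAntidiagonal.antidiagonal t, Phi γ d p.1 * γ (d + 1) ^ p.2 := by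
  simp only [Phi, Finset.sum_mul]
  rw [Finset.sum_sigma']
  refine Finset.sum_nbij'
    (fun a => ⟨(∑ i, Fin.init a i, a (Fin.last (d + 1))), Fin.init a⟩)
    (fun x => (Fin.snoc x.2 x.1.2 : Fin (d + 1 + 1) → ℕ)) ?_ ?_ ?_ ?_ ?_
  · intro a ha
    rw [Finset.Nat.mem_antidiagonalTuple, Fin.sum_univ_castSucc] at ha
    simpa [Finset.Nat.mem_antidiagonalTuple, Fin.init] using ha
  · rintro ⟨⟨p, q⟩, x⟩ hx
    simp only [Finset.mem_sigma, Finset.HasAntidiagonal.mem_antidiagonal,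
      Finset.Nat.mem_antidiagonalTuple] at hx
    rw [Finset.Nat.mem_antidiagonalTuple, Fin.sum_univ_castSucc]
    simp [hx.1, hx.2]
  · intro a _
    simp
  · rintro ⟨⟨p, q⟩, x⟩ hx
    simp only [Finset.mem_sigma, Finset.HasAntidiagonal.mem_antidiagonal,
      Finset.Nat.mem_antidiagonalTuple] at hx
    obtain ⟨-, rfl⟩ := hx
    simp
  · intro a _
    rw [Fin.prod_univ_castSucc]
    simp [Fin.init]

theorem Phi_zero_right (γ : ℕ → ℝ) (d : ℕ) : Phi γ d 0 = 1 := by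
  induction d with
  | zero => simp [Phi_zero_left]
  | succ d ih => simp [Phi_succ_left, ih]

theorem Phi_succ_succ (γ : ℕ → ℝ) (d t : ℕ) :
    Phi γ (d + 1) (t + 1) = Phi γ d (t + 1) + γ (d + 1) * Phi γ (d + 1) t := by
  rw [Phi_succ_left, Finset.Nat.sum_antidiagonal_succ', Phi_succ_left γ d t, Finset.mul_sum]
  simp only [pow_zero, mul_one, add_right_inj]
  exact Finset.sum_congr rfl fun p _ => by ring

theorem Phi_succ_right (γ : ℕ → ℝ) (d t : ℕ) :
    Phi γ d (t + 1) = ∑ i ∈ Finset.range (d + 1), Phi γ i t * γ i := by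
  induction d with
  | zero => simp [Phi_zero_left, pow_succ]
  | succ d ih => rw [Finset.sum_range_succ, ← ih, Phi_succ_succ]; ring

theorem Phi_nonneg {γ : ℕ → ℝ} {d : ℕ} (h : ∀ i ≤ d, 0 ≤ γ i) (t : ℕ) : 0 ≤ Phi γ d t :=
  Finset.sum_nonneg fun _ _ => Finset.prod_nonneg fun i _ =>
    pow_nonneg (h i (Nat.lt_succ_iff.mp i.isLt)) _

theorem summable_Phi {γ : ℕ → ℝ} {d : ℕ} (h : ∀ i ≤ d, 0 ≤ γ i) (h1 : ∀ i ≤ d, γ i < 1) :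
    Summable (Phi γ d) := by
  induction d with
  | zero =>
    simpa only [funext (Phi_zero_left γ)] using
      summable_geometric_of_lt_one (h 0 le_rfl) (h1 0 le_rfl)
  | succ d ih =>
    have hd := ih (fun i hi => h i (by omega)) (fun i hi => h1 i (by omega))
    have hg := summable_geometric_of_lt_one (h (d + 1) le_rfl) (h1 (d + 1) le_rfl)
    simpa only [funext (Phi_succ_left γ d)] using
      (summable_norm_sum_mul_antidiagonal_of_summable_norm hd.norm hg.norm).of_norm

theorem one_vecMul_Gam_pow (γ : ℕ → ℝ) (D t : ℕ) :
    Matrix.vecMul 1 (Gam γ D ^ t) = fun d : Fin (D + 1) => Phi γ d t := by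
  induction t with
  | zero => ext d; simp [Phi_zero_right]
  | succ t ih =>
    rw [pow_succ, ← Matrix.vecMul_vecMul, ih]
    ext j
    rw [Phi_succ_right]
    simp only [Matrix.vecMul, dotProduct, Gam, Matrix.of_apply, mul_ite, mul_zero, Fin.le_def]
    rw [Fin.sum_univ_eq_sum_range
      (fun i => if i ≤ (j : ℕ) then Phi γ i t * γ i else 0) (D + 1), ← Finset.sum_filter]
    refine Finset.sum_congr ?_ fun _ _ => rfl
    ext i
    simp only [Finset.mem_filter, Finset.mem_range]
    omega

theorem sum_Gam_pow_mulVec (γ : ℕ → ℝ) (D t : ℕ) (w : Fin (D + 1) → ℝ) :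
    ∑ d, ((Gam γ D ^ t).mulVec w) d = ∑ d : Fin (D + 1), w d * Phi γ d t := by
  have h := Matrix.dotProduct_mulVec (1 : Fin (D + 1) → ℝ) (Gam γ D ^ t) w
  rw [one_vecMul_Gam_pow, one_dotProduct] at h
  rw [h]
  exact Finset.sum_congr rfl fun d _ => mul_comm _ _

theorem Gam_pow_mulVec_nonneg {γ : ℕ → ℝ} {D : ℕ} (h : ∀ i ≤ D, 0 ≤ γ i)
    {w : Fin (D + 1) → ℝ} (hw : ∀ d, 0 ≤ w d) (t : ℕ) (d : Fin (D + 1)) :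
    0 ≤ ((Gam γ D ^ t).mulVec w) d := by
  induction t generalizing d with
  | zero => simpa using hw d
  | succ t ih =>
    rw [pow_succ', ← Matrix.mulVec_mulVec]
    rw [Matrix.mulVec, dotProduct]
    refine Finset.sum_nonneg fun j _ => mul_nonneg ?_ (ih j)
    simp only [Gam, Matrix.of_apply]
    split_ifs
    exacts [h d (Nat.lt_succ_iff.mp d.isLt), le_rfl]

theorem eucNorm_nonneg {m : ℕ} (v : Fin m → ℝ) : 0 ≤ eucNorm v := Real.sqrt_nonneg _

theorem eucNorm_le_sum {m : ℕ} {v : Fin m → ℝ} (hv : ∀ d, 0 ≤ v d) : eucNorm v ≤ ∑ d, v d :=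
  Real.sqrt_le_iff.mpr ⟨Finset.sum_nonneg fun d _ => hv d,
    Finset.sum_sq_le_sq_sum_of_nonneg fun d _ => hv d⟩

theorem traj_congr {S A : Type*} (T : S → A → S) (s : S) {a b : ℕ → A} {n : ℕ}
    (h : ∀ t < n, a t = b t) : traj T s a n = traj T s b n := by
  induction n with
  | zero => rfl
  | succ n ih => rw [traj, traj, ih fun t ht => h t (by omega), h n (by omega)]

theorem extSeq_restrict {A : Type*} [Nonempty A] (H : ℕ) (b : ℕ → A) {t : ℕ} (ht : t < H + 1) :
    extSeq H (fun i => b i) t = b t := by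
  simp [extSeq, ht]

section

variable {η u : ℕ → ℝ} {C : ℝ}

theorem summable_mul_of_abs_le (hη : Summable η) (h0 : ∀ t, 0 ≤ η t) (hu : ∀ t, |u t| ≤ C) :
    Summable fun t => η t * u t :=
  Summable.of_norm_bounded (hη.mul_right C) fun t => by
    rw [Real.norm_eq_abs, abs_mul, abs_of_nonneg (h0 t)]
    exact mul_le_mul_of_nonneg_left (hu t) (h0 t)

theorem abs_tsum_mul_le (hη : Summable η) (h0 : ∀ t, 0 ≤ η t) (hu : ∀ t, |u t| ≤ C) :
    |∑' t, η t * u t| ≤ (∑' t, η t) * C := by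
  rw [← Real.norm_eq_abs]
  refine tsum_of_norm_bounded (hη.hasSum.mul_right C) fun t => ?_
  rw [Real.norm_eq_abs, abs_mul, abs_of_nonneg (h0 t)]
  exact mul_le_mul_of_nonneg_left (hu t) (h0 t)

end

theorem abs_ciSup_le {ι : Sort*} [Nonempty ι] {f : ι → ℝ} {B : ℝ} (h : ∀ i, |f i| ≤ B) :
    |⨆ i, f i| ≤ B := by
  have hb : BddAbove (Set.range f) :=
    ⟨B, Set.forall_mem_range.mpr fun i => (abs_le.mp (h i)).2⟩
  exact abs_le.mpr ⟨(abs_le.mp (h (Classical.arbitrary ι))).1.trans (le_ciSup hb _),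
    ciSup_le fun i => (abs_le.mp (h i)).2⟩

theorem abs_Vstar_le {S A : Type*} [Nonempty A] (T : S → A → S) {r : S → A → ℝ} {C : ℝ}
    (hr : ∀ s a, |r s a| ≤ C) {η : ℕ → ℝ} (hη : Summable η) (h0 : ∀ t, 0 ≤ η t) (s : S) :
    |Vstar T r η s| ≤ (∑' t, η t) * C :=
  abs_ciSup_le fun _ => abs_tsum_mul_le hη h0 fun _ => hr _ _

theorem abs_ciSup_sub_ciSup_le {ι κ : Sort*} [Nonempty ι] [Nonempty κ] {f : ι → ℝ} {g : κ → ℝ}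
    {ε : ℝ} (hg : BddAbove (Set.range g)) (h₁ : ∀ i, ∃ k, f i ≤ g k + ε)
    (h₂ : ∀ k, ∃ i, g k ≤ f i + ε) : |(⨆ i, f i) - ⨆ k, g k| ≤ ε := by
  have hle : ∀ i, f i ≤ (⨆ k, g k) + ε := fun i => by
    obtain ⟨k, hk⟩ := h₁ i
    linarith [le_ciSup hg k]
  have hf : BddAbove (Set.range f) := ⟨_, Set.forall_mem_range.mpr hle⟩
  have h₃ : ⨆ i, f i ≤ (⨆ k, g k) + ε := ciSup_le hle
  have h₄ : ⨆ k, g k ≤ (⨆ i, f i) + ε := ciSup_le fun k => by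
    obtain ⟨i, hi⟩ := h₂ k
    linarith [le_ciSup hf i]
  exact abs_le.mpr ⟨by linarith, by linarith⟩

/-- Replacing the tail of a discounted return by a bounded terminal value `c * V` changes the
optimal value by at most the tail weight times the reward bound plus `c` times the value bound. -/
theorem abs_truncated_sub_Vstar_le {S A : Type*} [Nonempty A] (T : S → A → S) {r : S → A → ℝ}
    {C : ℝ} (hr : ∀ s a, |r s a| ≤ C) {η : ℕ → ℝ} (hη : Summable η) (h0 : ∀ t, 0 ≤ η t)
    {V : S → ℝ} {B : ℝ} (hV : ∀ s, |V s| ≤ B) {c : ℝ} (hc : 0 ≤ c) (H : ℕ) (s : S) :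
    |(⨆ a : Fin (H + 1) → A,
        (∑ t ∈ Finset.range (H + 1), η t * r (traj T s (extSeq H a) t) (extSeq H a t))
          + c * V (traj T s (extSeq H a) (H + 1))) - Vstar T r η s|
      ≤ (∑' t, η (t + (H + 1))) * C + c * B := by
  set F : (ℕ → A) → ℝ := fun b =>
    (∑ t ∈ Finset.range (H + 1), η t * r (traj T s b t) (b t)) + c * V (traj T s b (H + 1))
    with hF
  set G : (ℕ → A) → ℝ := fun b => ∑' t, η t * r (traj T s b t) (b t) with hG
  have hFG : ∀ b, |F b - G b| ≤ (∑' t, η (t + (H + 1))) * C + c * B := fun b => by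
    have hs := summable_mul_of_abs_le (u := fun t => r (traj T s b t) (b t)) hη h0
      fun _ => hr _ _
    have hsplit := hs.sum_add_tsum_nat_add (H + 1)
    have htail := abs_tsum_mul_le (u := fun t => r (traj T s b (t + (H + 1))) (b (t + (H + 1))))
      ((summable_nat_add_iff (H + 1)).mpr hη) (fun _ => h0 _) fun _ => hr _ _
    have hterm : |c * V (traj T s b (H + 1))| ≤ c * B := by
      rw [abs_mul, abs_of_nonneg hc]
      exact mul_le_mul_of_nonneg_left (hV _) hc
    have heq : F b - G b = c * V (traj T s b (H + 1))
        - ∑' t, η (t + (H + 1)) * r (traj T s b (t + (H + 1))) (b (t + (H + 1))) := by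
      simp only [hF, hG, ← hsplit]
      ring
    rw [heq]
    linarith [abs_sub (c * V (traj T s b (H + 1)))
      (∑' t, η (t + (H + 1)) * r (traj T s b (t + (H + 1))) (b (t + (H + 1))))]
  have hrestrict : ∀ b : ℕ → A, F (extSeq H fun i => b i) = F b := fun b => by
    have hb : ∀ n ≤ H + 1, ∀ t < n, extSeq H (fun i => b i) t = b t :=
      fun n hn t ht => extSeq_restrict H b (ht.trans_le hn)
    simp only [hF]
    rw [traj_congr T s (hb _ le_rfl)]
    congr 1
    refine Finset.sum_congr rfl fun t ht => ?_
    have ht' := Finset.mem_range.mp ht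
    rw [traj_congr T s (hb t ht'.le), hb _ le_rfl t ht']
  refine abs_ciSup_sub_ciSup_le (f := fun a : Fin (H + 1) → A => F (extSeq H a)) (g := G)
    ⟨(∑' t, η t) * C, ?_⟩ (fun a => ⟨extSeq H a, ?_⟩) (fun b => ⟨fun i => b i, ?_⟩)
  · exact Set.forall_mem_range.mpr fun b =>
      (abs_le.mp (abs_tsum_mul_le hη h0 fun _ => hr _ _)).2
  · linarith [(abs_le.mp (hFG (extSeq H a))).2]
  · simp only [hrestrict]
    linarith [(abs_le.mp (hFG b)).1]

/-- convergence of the proxy value, justifying the H-close algorithm: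
with `η(t) = Σ_d w_d Φ_d(t)` and the proxy
`Ṽ*_{η,H}(s) = sup_{(a_0,...,a_H)} [ Σ_{t=0}^H ⟨1, Γ^t w⟩ r(s_t,a_t) + ‖Γ^{H+1} w‖ V*(s_{H+1}) ]`
(Euclidean norm, `V*` the γ_0-discounted optimal value), one has
`lim_{H→∞} Ṽ*_{η,H}(s) = V*_η(s)`. -/
theorem stmt14 {S A : Type*} [Nonempty A] (T : S → A → S) (r : S → A → ℝ)
    (hr : ∃ C, ∀ s a, |r s a| ≤ C)
    (D : ℕ) (γ : ℕ → ℝ)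
    (hpos : ∀ d ≤ D, 0 < γ d) (hlt : γ 0 < 1)
    (hmono : ∀ i j, i < j → j ≤ D → γ j < γ i)
    (w : Fin (D + 1) → ℝ) (hw : ∀ d, 0 ≤ w d) (hw0 : w ≠ 0) (s : S) :
    Filter.Tendsto
      (fun H : ℕ =>
        ⨆ a : Fin (H + 1) → A,
          ((∑ t ∈ Finset.range (H + 1),
              (∑ d : Fin (D + 1), ((Gam γ D ^ t).mulVec w) d)
                * r (traj T s (extSeq H a) t) (extSeq H a t))
            + eucNorm ((Gam γ D ^ (H + 1)).mulVec w)
                * Vstar T r (fun t => γ 0 ^ t) (traj T s (extSeq H a) (H + 1))))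
      Filter.atTop
      (nhds (Vstar T r (fun t => ∑ d : Fin (D + 1), w d * Phi γ d t) s)) := by
  obtain ⟨C, hr⟩ := hr
  have hγ0 : ∀ i ≤ D, 0 ≤ γ i := fun i hi => (hpos i hi).le
  have hγ1 : ∀ i ≤ D, γ i < 1 := fun i hi => by
    rcases i.eq_zero_or_pos with rfl | h
    · exact hlt
    · exact (hmono 0 i h hi).trans hlt
  have hle : ∀ d : Fin (D + 1), (d : ℕ) ≤ D := fun d => Nat.lt_succ_iff.mp d.isLt
  set η : ℕ → ℝ := fun t => ∑ d : Fin (D + 1), w d * Phi γ d t with hη_def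
  have hη0 : ∀ t, 0 ≤ η t := fun t => Finset.sum_nonneg fun d _ =>
    mul_nonneg (hw d) (Phi_nonneg (fun i hi => hγ0 i (hi.trans (hle d))) t)
  have hη : Summable η := summable_sum fun d _ => (summable_Phi
    (fun i hi => hγ0 i (hi.trans (hle d))) fun i hi => hγ1 i (hi.trans (hle d))).mul_left (w d)
  have hsum : ∀ t, ∑ d, ((Gam γ D ^ t).mulVec w) d = η t := fun t => sum_Gam_pow_mulVec γ D t w
  have hgeom := summable_geometric_of_lt_one (hγ0 0 D.zero_le) hlt
  have hV := abs_Vstar_le T hr hgeom fun t => pow_nonneg (hγ0 0 D.zero_le) t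
  have hnorm : Filter.Tendsto (fun H : ℕ => eucNorm ((Gam γ D ^ (H + 1)).mulVec w))
      Filter.atTop (nhds 0) :=
    squeeze_zero (fun H => eucNorm_nonneg _)
      (fun H => (eucNorm_le_sum (Gam_pow_mulVec_nonneg hγ0 hw (H + 1))).trans_eq (hsum (H + 1)))
      ((Filter.tendsto_add_atTop_iff_nat 1).mpr hη.tendsto_atTop_zero)
  have htail : Filter.Tendsto (fun H : ℕ => ∑' t, η (t + (H + 1))) Filter.atTop (nhds 0) :=
    (Filter.tendsto_add_atTop_iff_nat 1).mpr (tendsto_sum_nat_add η)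
  rw [tendsto_iff_dist_tendsto_zero]
  refine squeeze_zero (fun _ => dist_nonneg) (fun H => ?_)
    (by simpa using (htail.mul_const C).add (hnorm.mul_const ((∑' t, γ 0 ^ t) * C)))
  simp only [hsum]
  exact abs_truncated_sub_Vstar_le T hr hη hη0 hV (eucNorm_nonneg _) H s
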